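/- Let I ⊂ ℝ be a finite interval, N ∈ ℤ_{≥1}, and let ϑ be the Riemann–Siegel theta branch. There is a constant C depending only on I and N such that for all s = σ + it with σ ∈ I and t ≠ 0, |i·ϑ(s) − (s/2 − 1/4)·log(|t|/(2π)) + it/2 + sgn(t)·iπ/8 + Σ_{n=1}^{N−1} (2i/t)^n·[B_{n+1}(σ/2) + (−1)^{n+1}·B_{n+1}((1−σ)/2)]/(2n(n+1))| ≤ C/|t|^N, where log(|t|/(2π)) is the real logarithm. -/

import Mathlib

open Complex Real MeasureTheory
noncomputable section
def chi (s : ℂ) : ℂ := (π : ℂ) ^ (s - 1/2) * Complex.Gamma ((1 - s)/2) / Complex.Gamma (s/2)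

def RSOmega : Set ℂ := {s : ℂ | s.im ≠ 0 ∨ (0 < s.re ∧ s.re < 1)}

def IsRSTheta (ϑ : ℂ → ℂ) : Prop :=
  DifferentiableOn ℂ ϑ RSOmega ∧ (∀ s ∈ RSOmega, Complex.exp (-2 * I * ϑ s) = chi s) ∧
    ϑ (1/2) = 0

def zetaSum (x : ℝ) (s : ℂ) : ℂ := ∑ n ∈ Finset.Icc 1 ⌊x⌋₊, (n : ℂ) ^ (-s)

def Upsilon (u τ : ℂ) : ℂ :=
  ∫ v : ℝ, Complex.exp (3 * (π:ℂ) * I / 4) *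
    (Complex.exp (-(π:ℂ) * I * τ * (1/2 + Complex.exp (3 * (π:ℂ) * I / 4) * v) ^ 2
        + 2 * (π:ℂ) * I * u * (1/2 + Complex.exp (3 * (π:ℂ) * I / 4) * v)) /
      (Complex.exp (2 * (π:ℂ) * I * (1/2 + Complex.exp (3 * (π:ℂ) * I / 4) * v)) - 1))

def G (u τ : ℂ) : ℂ :=
  τ ^ ((1:ℂ)/4) * Complex.exp (-(π:ℂ) * I * u ^ 2 / 2 + (π:ℂ) * I / 8) *
    Upsilon (τ ^ ((1:ℂ)/2) * u) τ

def Gderiv (k : ℕ) (u τ : ℂ) : ℂ := iteratedDeriv k (fun w => G w τ) u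

def hermiteH (n : ℕ) (x : ℂ) : ℂ :=
  (Nat.factorial n : ℂ) * ∑ j ∈ Finset.range (n / 2 + 1),
    (-1:ℂ) ^ j / ((Nat.factorial j : ℂ) * (Nat.factorial (n - 2*j) : ℂ)) * (2 * x) ^ (n - 2*j)

def obell (p : ℕ → ℂ) (i j : ℕ) : ℂ :=
  ∑ f ∈ (Finset.Nat.antidiagonalTuple j i).filter (fun f => ∀ l, 1 ≤ f l), ∏ l, p (f l)

def bernoulliPoly (n : ℕ) (x : ℂ) : ℂ := Polynomial.aeval x (Polynomial.bernoulli n)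

def fseq (σ : ℝ) (n : ℕ) : ℂ :=
  (bernoulliPoly (n+1) ((σ:ℂ)/2) + (-1:ℂ)^(n+1) * bernoulliPoly (n+1) ((1-(σ:ℂ))/2)) /
    (2*(n:ℂ)*((n:ℂ)+1))

def um (m : ℕ) (σ : ℝ) : ℂ :=
  (-2:ℂ)^m * ∑ k ∈ Finset.range (m+1), obell (fseq σ) m k / (Nat.factorial k : ℂ)

def seqA (j : ℕ) : ℂ := (-1:ℂ)^(j+1) / ((j:ℂ) + 2)

def seqB (j : ℕ) : ℂ := (-1:ℂ)^(j+1) / (j:ℂ)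

def dd (m r : ℕ) (σ : ℝ) : ℂ :=
  ∑ n ∈ Finset.Icc r m, (obell seqA n r / (Nat.factorial r : ℂ)) *
    ∑ k ∈ Finset.range (m - n + 1),
      (obell seqB (m - n) k / (Nat.factorial k : ℂ)) * ((σ:ℂ) - 1)^k

def qq (n ℓ : ℕ) (σ : ℝ) : ℂ :=
  ∑ m ∈ Finset.Icc (ℓ - n) (ℓ / 3), um m σ * dd (n - 2*m) (n + m - ℓ) σ

def PP (n k : ℕ) (x : ℂ) (σ : ℝ) : ℂ :=
  Complex.exp (3 * (π:ℂ) * I * (k:ℂ) / 4) * ∑ ℓ ∈ Finset.range (k/2 + 1),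
    (Nat.choose (3*n - 2*ℓ) (3*n - k) : ℂ) * (-1:ℂ)^(n + ℓ) * 2^(2*ℓ) / 2^k *
      qq n ℓ σ * hermiteH (k - 2*ℓ) (Complex.exp (-(π:ℂ) * I / 4) * x)

def IsAk (s : ℂ) (a : ℕ → ℂ) : Prop :=
  a 0 = 1 ∧ ∀ k : ℕ, ((k:ℂ) + 1) * (Real.sqrt s.im : ℂ) * a (k+1) =
    -((k:ℂ) + 1 - (s.re:ℂ)) * a k + I * (if 2 ≤ k then a (k-2) else 0)

def IsPsi (Ψ : ℂ → ℂ) : Prop :=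
  Differentiable ℂ Ψ ∧ ∀ u : ℂ, Complex.cos ((π:ℂ)*u) ≠ 0 →
    Ψ u = Complex.cos ((π:ℂ)*(u^2/2 - u - 1/8)) / Complex.cos ((π:ℂ)*u)

def wfun (s z : ℂ) : ℂ :=
  Complex.exp ((s - 1) * Complex.log (1 + z / (Real.sqrt s.im : ℂ))
    - I * (Real.sqrt s.im : ℂ) * z + I * z^2 / 2)

def rn (n : ℕ) (s z : ℂ) : ℂ :=
  wfun s z - ∑ k ∈ Finset.range n, (iteratedDeriv k (wfun s) 0 / (Nat.factorial k : ℂ)) * z^k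

def GammaOmega : Set ℂ := {s : ℂ | s.im ≠ 0 ∨ 0 < s.re}

def IsLogGamma (L : ℂ → ℂ) : Prop :=
  DifferentiableOn ℂ L GammaOmega ∧ (∀ s ∈ GammaOmega, Complex.exp (L s) = Complex.Gamma s) ∧
    L 1 = 0

def gseq (σ : ℝ) (n : ℕ) : ℂ := -(bernoulliPoly (n+1) (σ:ℂ)) / ((n:ℂ)*((n:ℂ)+1))

def gammam (m : ℕ) (σ : ℝ) : ℂ :=
  I^m * ∑ k ∈ Finset.range (m+1), obell (gseq σ) m k / (Nat.factorial k : ℂ)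

lemma em_deriv_sum (M : ℕ) (g : ℕ → ℝ → ℂ) (a : ℝ) :
    HasDerivAt (fun a : ℝ => ∑ n ∈ Finset.range (M+1),
      ((bernoulliFun (n+1) a : ℝ) : ℂ) / ((n+1).factorial : ℂ) * (g n 1 - g n 0))
      ((g 0 1 - g 0 0) + ∑ n ∈ Finset.range M,
      ((bernoulliFun (n+1) a : ℝ) : ℂ) / ((n+1).factorial : ℂ) * (g (n+1) 1 - g (n+1) 0)) a := by
  have key : HasDerivAt (fun a : ℝ => ∑ n ∈ Finset.range (M+1),
      ((bernoulliFun (n+1) a : ℝ) : ℂ) / ((n+1).factorial : ℂ) * (g n 1 - g n 0))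
      (∑ n ∈ Finset.range (M+1),
      ((((n+1 : ℕ) : ℝ) * bernoulliFun (n+1-1) a : ℝ) : ℂ) / ((n+1).factorial : ℂ) *
        (g n 1 - g n 0)) a := by
    apply HasDerivAt.fun_sum
    intro n _
    exact ((hasDerivAt_bernoulliFun (n+1) a).ofReal_comp.div_const _).mul_const _
  convert key using 1
  rw [Finset.sum_range_succ', add_comm]
  congr 1
  · apply Finset.sum_congr rfl
    intro n _
    have h1 : ((n+1).factorial : ℂ) ≠ 0 := by exact_mod_cast Nat.factorial_ne_zero _
    have h2 : ((n:ℂ)+1+1) ≠ 0 := by exact_mod_cast Nat.succ_ne_zero (n+1)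
    rw [Nat.factorial_succ (n+1)]
    simp only [Nat.add_sub_cancel]
    push_cast
    field_simp
  · simp

lemma em_bound (M : ℕ) : ∀ (g : ℕ → ℝ → ℂ) (R K : ℝ), 1 ≤ R →
    (∀ m, ∀ x ∈ Set.Icc (-R) R, HasDerivAt (g m) (g (m+1) x) x) →
    (∀ x ∈ Set.Icc (-R) R, ‖g (M+1) x‖ ≤ K) → ∀ a ∈ Set.Icc (-R) R,
    ‖(∫ x in (0:ℝ)..1, g 0 x) + ∑ n ∈ Finset.range M,
      ((bernoulliFun (n+1) a : ℝ) : ℂ) / ((n+1).factorial : ℂ) * (g n 1 - g n 0) - g 0 a‖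
      ≤ (2*R)^(M+1) * K := by
  -- general fact
  have gen : ∀ (E E' : ℝ → ℂ) (R K : ℝ), 1 ≤ R →
      (∀ x ∈ Set.Icc (-R) R, HasDerivAt E (E' x) x) → (∀ x ∈ Set.Icc (-R) R, ‖E' x‖ ≤ K) →
      ∀ a ∈ Set.Icc (-R) R, ‖(∫ x in (0:ℝ)..1, E x) - E a‖ ≤ 2*R*K := by
    intro E E' R K hR hd hb a ha
    have hK : 0 ≤ K := (norm_nonneg _).trans (hb a ha)
    have hsub : Set.uIcc (0:ℝ) 1 ⊆ Set.Icc (-R) R := by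
      rw [Set.uIcc_of_le zero_le_one]
      exact Set.Icc_subset_Icc (by linarith) hR
    have hint : IntervalIntegrable E volume 0 1 :=
      ContinuousOn.intervalIntegrable fun x hx => (hd x (hsub hx)).continuousAt.continuousWithinAt
    have : (∫ x in (0:ℝ)..1, E x) - E a = ∫ x in (0:ℝ)..1, (E x - E a) := by
      rw [intervalIntegral.integral_sub hint (by simp)]
      simp
    rw [this]
    have h2 := intervalIntegral.norm_integral_le_of_norm_le_const (a := (0:ℝ)) (b := 1)
      (f := fun x => E x - E a) (C := 2*R*K) (by
      intro x hx
      have hx' := hsub (Set.uIoc_subset_uIcc hx)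
      have := (convex_Icc (-R) R).norm_image_sub_le_of_norm_hasDerivWithin_le (f := E) (f' := E')
        (C := K) (fun y hy => (hd y hy).hasDerivWithinAt) hb ha hx'
      refine this.trans ?_
      have : ‖x - a‖ ≤ 2*R := by
        rw [Real.norm_eq_abs, abs_le]
        constructor <;> linarith [ha.1, ha.2, hx'.1, hx'.2]
      nlinarith)
    simpa using h2
  induction M with
  | zero =>
    intro g R K hR hd hb a ha
    simpa using gen (g 0) (g 1) R K hR (hd 0) hb a ha
  | succ M ih =>
    intro g R K hR hd hb a ha
    have hsub : Set.uIcc (0:ℝ) 1 ⊆ Set.Icc (-R) R := by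
      rw [Set.uIcc_of_le zero_le_one]
      exact Set.Icc_subset_Icc (by linarith) hR
    have hint : ∀ m, IntervalIntegrable (g m) volume 0 1 := fun m =>
      ContinuousOn.intervalIntegrable fun x hx => (hd m x (hsub hx)).continuousAt.continuousWithinAt
    have ih' := ih (fun m => g (m+1)) R K hR (fun m => hd (m+1)) hb
    have hftc : ∫ x in (0:ℝ)..1, g 1 x = g 0 1 - g 0 0 :=
      intervalIntegral.integral_eq_sub_of_hasDerivAt (fun x hx => hd 0 x (hsub hx)) (hint 1)
    set E : ℝ → ℂ := fun a => (∫ x in (0:ℝ)..1, g 0 x) + ∑ n ∈ Finset.range (M+1),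
      ((bernoulliFun (n+1) a : ℝ) : ℂ) / ((n+1).factorial : ℂ) * (g n 1 - g n 0) - g 0 a with hE
    have hEi : ∫ x in (0:ℝ)..1, E x = 0 := by
      have hs : ∀ n, IntervalIntegrable (fun a : ℝ => ((bernoulliFun (n+1) a : ℝ) : ℂ) /
          ((n+1).factorial : ℂ) * (g n 1 - g n 0)) volume 0 1 := by
        intro n
        apply Continuous.intervalIntegrable
        fun_prop
      have hs' : IntervalIntegrable (fun a : ℝ => ∑ n ∈ Finset.range (M+1),
          ((bernoulliFun (n+1) a : ℝ) : ℂ) /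
          ((n+1).factorial : ℂ) * (g n 1 - g n 0)) volume 0 1 := by
        apply Continuous.intervalIntegrable
        fun_prop
      rw [hE, intervalIntegral.integral_sub (IntervalIntegrable.add (by simp) hs') (hint 0),
        intervalIntegral.integral_add (by simp) hs',
        intervalIntegral.integral_finsetSum (fun n _ => hs n)]
      have : ∀ n, ∫ x in (0:ℝ)..1, ((bernoulliFun (n+1) x : ℝ) : ℂ) /
          ((n+1).factorial : ℂ) * (g n 1 - g n 0) = 0 := by
        intro n
        rw [intervalIntegral.integral_mul_const, intervalIntegral.integral_div,
          intervalIntegral.integral_ofReal, integral_bernoulliFun_eq_zero (Nat.succ_ne_zero n)]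
        simp
      simp [this]
    have := gen E (fun a => (g 0 1 - g 0 0) + ∑ n ∈ Finset.range M,
      ((bernoulliFun (n+1) a : ℝ) : ℂ) / ((n+1).factorial : ℂ) * (g (n+1) 1 - g (n+1) 0) - g 1 a)
      R ((2*R)^(M+1)*K) hR (fun x hx => ((em_deriv_sum M g x).const_add _).sub (hd 0 x hx))
      (fun x hx => by
        have := ih' x hx
        rwa [hftc] at this) a ha
    rw [hEi, zero_sub, norm_neg] at this
    calc _ ≤ _ := this
      _ = _ := by ring
def stirS (M : ℕ) (a : ℝ) (z : ℂ) : ℂ :=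
  (z + a - 1/2) * Complex.log z - z + ∑ n ∈ Finset.range M,
    (-1)^n * ((bernoulliFun (n+2) a : ℝ) : ℂ) / (((n:ℂ)+1)*((n:ℂ)+2)) / z^(n+1)

def stirg (z : ℂ) : ℕ → ℝ → ℂ
  | 0 => fun x => Complex.log (z + x)
  | (n+1) => fun x => (-1)^n * (n.factorial : ℂ) / (z + x)^(n+1)

lemma slit_aux {z : ℂ} {R x : ℝ} (hR : 1 ≤ R) (hz : 0 ≤ z.re) (hz2 : 2*R ≤ ‖z‖) (hx : -R ≤ x) :
    z + x ∈ Complex.slitPlane := by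
  rw [Complex.mem_slitPlane_iff]
  by_cases h : z.im = 0
  · left
    have : ‖z‖ = z.re := by
      have : z = (z.re : ℂ) := Complex.ext rfl (by simp [h])
      rw [this, Complex.norm_real]
      simp [abs_of_nonneg hz]
    simp
    linarith
  · right; simpa using h

lemma norm_aux {z : ℂ} {R x : ℝ} (hz2 : 2*R ≤ ‖z‖) (hx : x ∈ Set.Icc (-R) R) :
    ‖z‖/2 ≤ ‖z + x‖ := by
  have h1 : ‖z‖ ≤ ‖z + x‖ + ‖(x:ℂ)‖ := by
    have := norm_sub_le (z + x) (x:ℂ)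
    simpa using this
  have h2 : ‖(x:ℂ)‖ ≤ R := by
    rw [Complex.norm_real, Real.norm_eq_abs]; exact abs_le.2 hx
  linarith

lemma stirg_deriv {z : ℂ} {R : ℝ} (hR : 1 ≤ R) (hz : 0 ≤ z.re) (hz2 : 2*R ≤ ‖z‖) (m : ℕ)
    (x : ℝ) (hx : x ∈ Set.Icc (-R) R) : HasDerivAt (stirg z m) (stirg z (m+1) x) x := by
  have hs := slit_aux hR hz hz2 hx.1
  have hne : z + x ≠ 0 := Complex.slitPlane_ne_zero hs
  have h0 : HasDerivAt (fun x : ℝ => z + (x:ℂ)) 1 x :=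
    (HasDerivAt.ofReal_comp (hasDerivAt_id x)).const_add z |>.congr_deriv (by simp)
  cases m with
  | zero =>
    have := h0.clog_real hs
    simpa [stirg] using this
  | succ n =>
    have := ((h0.fun_pow (n+1)).inv (pow_ne_zero _ hne)).const_mul ((-1)^n * (n.factorial : ℂ))
    refine (this.congr_deriv ?_)
    simp only [stirg]
    rw [Nat.factorial_succ]
    push_cast
    field_simp
    ring

lemma stir_step (M : ℕ) (R a : ℝ) (z : ℂ) (hR : 1 ≤ R) (hz : 0 ≤ z.re) (hz2 : 2*R ≤ ‖z‖)
    (ha : a ∈ Set.Icc (-R) R) :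
    ‖stirS M a (z+1) - stirS M a z - Complex.log (z + a)‖ ≤
      (2*R)^(M+2) * ((M+1).factorial * 2^(M+2)) * (1/‖z‖^(M+2)) := by
  have hzpos : 0 < ‖z‖ := by linarith
  have h := em_bound (M+1) (stirg z) R ((M+1).factorial / (‖z‖/2)^(M+2)) hR
    (fun m x hx => stirg_deriv hR hz hz2 m x hx) (by
      intro x hx
      simp only [stirg, norm_div, norm_mul, norm_pow, norm_neg, norm_one, one_pow, one_mul,
        Complex.norm_natCast]
      have := norm_aux hz2 hx
      gcongr) a ha
  have hint : ∫ x in (0:ℝ)..1, stirg z 0 x =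
      (z+1) * Complex.log (z+1) - z * Complex.log z - 1 := by
    have hsub : Set.uIcc (0:ℝ) 1 ⊆ Set.Icc (-R) R := by
      rw [Set.uIcc_of_le zero_le_one]
      exact Set.Icc_subset_Icc (by linarith) hR
    rw [intervalIntegral.integral_eq_sub_of_hasDerivAt
      (f := fun x : ℝ => (z + x) * Complex.log (z + x) - (z+x))]
    · simp; ring
    · intro x hx
      have hs := slit_aux hR hz hz2 (hsub hx).1
      have hne : z + x ≠ 0 := Complex.slitPlane_ne_zero hs
      have h0 : HasDerivAt (fun x : ℝ => z + (x:ℂ)) 1 x :=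
        (HasDerivAt.ofReal_comp (hasDerivAt_id x)).const_add z |>.congr_deriv (by simp)
      refine ((h0.mul (h0.clog_real hs)).sub h0).congr_deriv ?_
      simp only [stirg]
      field_simp
      ring
    · exact ContinuousOn.intervalIntegrable fun x hx =>
        (stirg_deriv hR hz hz2 0 x (hsub hx)).continuousAt.continuousWithinAt
  rw [hint, Finset.sum_range_succ'] at h
  have heq : stirS M a (z+1) - stirS M a z - Complex.log (z + a) =
      (z+1) * Complex.log (z+1) - z * Complex.log z - 1 +
      (∑ n ∈ Finset.range M, ((bernoulliFun (n+1+1) a : ℝ) : ℂ) / ((n+1+1).factorial : ℂ) *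
        (stirg z (n+1) 1 - stirg z (n+1) 0) + ((bernoulliFun (0+1) a : ℝ) : ℂ) /
          ((0+1).factorial : ℂ) * (stirg z 0 1 - stirg z 0 0)) - stirg z 0 a := by
    have hsum : ∑ n ∈ Finset.range M, ((bernoulliFun (n+1+1) a : ℝ) : ℂ) / ((n+1+1).factorial : ℂ) *
        (stirg z (n+1) 1 - stirg z (n+1) 0) = (∑ n ∈ Finset.range M,
    (-1)^n * ((bernoulliFun (n+2) a : ℝ) : ℂ) / (((n:ℂ)+1)*((n:ℂ)+2)) / (z+1)^(n+1)) -
    ∑ n ∈ Finset.range M,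
    (-1)^n * ((bernoulliFun (n+2) a : ℝ) : ℂ) / (((n:ℂ)+1)*((n:ℂ)+2)) / z^(n+1) := by
      rw [← Finset.sum_sub_distrib]
      apply Finset.sum_congr rfl
      intro n _
      have h1 : (n.factorial : ℂ) ≠ 0 := by exact_mod_cast Nat.factorial_ne_zero _
      have h2 : ((n:ℂ)+1+1) ≠ 0 := by exact_mod_cast Nat.succ_ne_zero (n+1)
      have h3 : ((n:ℂ)+1) ≠ 0 := by exact_mod_cast Nat.succ_ne_zero (n)
      have e : ((n:ℂ)+2) = (n:ℂ)+1+1 := by ring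
      have h4 : (((n+1+1).factorial : ℕ) : ℂ) = ((n:ℂ)+1+1) * (((n:ℂ)+1) * n.factorial) := by
        rw [Nat.factorial_succ, Nat.factorial_succ]; push_cast; ring
      simp only [stirg]
      rw [h4, e]
      push_cast
      rw [add_zero, div_mul_eq_mul_div, mul_sub, sub_div]
      congr 1
      · field_simp
      · field_simp
    rw [hsum]
    simp only [stirS, stirg]
    simp
    ring
  rw [heq]
  refine h.trans (le_of_eq ?_)
  rw [div_pow]
  field_simp
def LGn (n : ℕ) (w : ℂ) : ℂ :=
  w * (Real.log n : ℂ) + (Real.log n.factorial : ℂ) - ∑ k ∈ Finset.range (n+1), Complex.log (w + k)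

lemma sum_inv_aux (M n : ℕ) (z : ℂ) (hz : 0 ≤ z.re) (hz2 : 2 ≤ ‖z‖) :
    ∑ k ∈ Finset.range n, 1/‖z + k‖^(M+2) ≤ 4/‖z‖^(M+1) := by
  have hr : 0 < ‖z‖ := by linarith
  set r := ‖z‖ with hrdef
  have h1 : ∀ k : ℕ, r^2 + (k:ℝ)^2 ≤ ‖z + k‖^2 := by
    intro k
    rw [hrdef, ← Complex.normSq_eq_norm_sq, ← Complex.normSq_eq_norm_sq, Complex.normSq_apply,
      Complex.normSq_apply]
    simp
    have : 0 ≤ z.re * k := by positivity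
    nlinarith
  have h2 : ∀ k : ℕ, 1/‖z + k‖^(M+2) ≤ 2/r^M * (1/(r + k - 1) - 1/(r + (k+1:ℕ) - 1)) := by
    intro k
    have hk : (0:ℝ) ≤ k := Nat.cast_nonneg k
    have h3 := h1 k
    have h4 : r ≤ ‖z + k‖ := by
      apply (sq_le_sq₀ hr.le (norm_nonneg _)).1
      nlinarith
    have h5 : 1/(r + k - 1) - 1/(r + (k+1:ℕ) - 1) = 1/((r+k-1)*(r+k)) := by
      have : r + k - 1 ≠ 0 := by linarith
      have : r + k ≠ 0 := by linarith
      push_cast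
      rw [show r + (k + 1) - 1 = r + (k:ℝ) by ring]
      field_simp
      ring
    rw [h5, div_mul_div_comm, pow_add]
    have h6 : (r+k-1)*(r+k) ≤ 2 * ‖z+k‖^2 := by nlinarith [sq_nonneg (r - k)]
    have h7 : r^M ≤ ‖z+k‖^M := by gcongr
    have h8 : 0 < (r+k-1)*(r+k) := by
      apply mul_pos <;> linarith
    have h9 : 0 < ‖z+k‖ := by linarith
    rw [div_le_div_iff₀ (by positivity) (mul_pos (by positivity) h8)]
    nlinarith [mul_le_mul h7 h6 h8.le (by positivity)]
  calc ∑ k ∈ Finset.range n, 1/‖z + k‖^(M+2)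
      ≤ ∑ k ∈ Finset.range n, 2/r^M * (1/(r + k - 1) - 1/(r + (k+1:ℕ) - 1)) :=
        Finset.sum_le_sum fun k _ => h2 k
    _ = 2/r^M * (1/(r-1) - 1/(r+n-1)) := by
        rw [← Finset.mul_sum, Finset.sum_range_sub' (fun k : ℕ => 1/(r + (k:ℝ) - 1))]
        simp
    _ ≤ 2/r^M * (2/r) := by
        gcongr
        have : 0 ≤ 1/(r+n-1) := by
          have : (0:ℝ) ≤ n := Nat.cast_nonneg n
          apply div_nonneg <;> linarith
        have h : 1/(r-1) ≤ 2/r := by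
          rw [div_le_div_iff₀ (by linarith) hr]; linarith
        linarith
    _ = _ := by rw [pow_succ]; field_simp; norm_num

lemma LGn_stir (M n : ℕ) (R a : ℝ) (z : ℂ) (hR : 1 ≤ R) (hz : 0 ≤ z.re) (hz2 : 2*R ≤ ‖z‖)
    (ha : a ∈ Set.Icc (-R) R) :
    ‖LGn n (z + a) - stirS M a z - ((z + a) * (Real.log n : ℂ) + (Real.log n.factorial : ℂ)
      - stirS M a (z + (n+1:ℕ)))‖ ≤
      (2*R)^(M+2) * ((M+1).factorial * 2^(M+2)) * (4/‖z‖^(M+1)) := by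
  have heq : LGn n (z + a) - stirS M a z - ((z + a) * (Real.log n : ℂ) +
      (Real.log n.factorial : ℂ) - stirS M a (z + (n+1:ℕ))) =
      ∑ k ∈ Finset.range (n+1), (stirS M a (z + k + 1) - stirS M a (z+k) -
        Complex.log (z + k + a)) := by
    rw [Finset.sum_sub_distrib]
    have : ∑ k ∈ Finset.range (n+1), (stirS M a (z + k + 1) - stirS M a (z+k)) =
        stirS M a (z + (n+1:ℕ)) - stirS M a z := by
      have := Finset.sum_range_sub (fun k : ℕ => stirS M a (z + k)) (n+1)
      simpa [add_assoc] using this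
    rw [this, LGn]
    have : ∀ k : ℕ, z + (k:ℂ) + a = z + a + k := fun k => by ring
    simp only [this]
    ring
  rw [heq]
  refine (norm_sum_le _ _).trans ?_
  have hn : ∀ k : ℕ, ‖z‖ ≤ ‖z + k‖ := by
    intro k
    apply (sq_le_sq₀ (norm_nonneg _) (norm_nonneg _)).1
    rw [← Complex.normSq_eq_norm_sq, ← Complex.normSq_eq_norm_sq, Complex.normSq_apply,
      Complex.normSq_apply]
    simp
    have : 0 ≤ z.re * k := by positivity
    nlinarith
  refine (Finset.sum_le_sum fun k _ => stir_step M R a (z + (k:ℕ)) hR (by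
    simp; positivity) (hz2.trans (hn k)) ha).trans ?_
  rw [← Finset.mul_sum]
  gcongr
  exact sum_inv_aux M (n+1) z hz (by linarith)

lemma stirling_lim : ∃ c : ℝ, Filter.Tendsto (fun n : ℕ => Real.log n.factorial -
    (n + 1/2) * Real.log n + n) Filter.atTop (nhds c) := by
  refine ⟨Real.log (√π) + 1/2 * Real.log 2, ?_⟩
  have h := (Real.continuousAt_log (x := √π) (by positivity)).tendsto.comp
    Stirling.tendsto_stirlingSeq_sqrt_pi
  refine (h.add_const (1/2 * Real.log 2)).congr' ?_
  filter_upwards [Filter.eventually_gt_atTop 0] with n hn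
  have hn' : (n:ℝ) ≠ 0 := by positivity
  simp only [Function.comp_apply]
  rw [Stirling.log_stirlingSeq_formula, Real.log_mul (by norm_num) hn',
    Real.log_div hn' (by positivity), Real.log_exp]
  ring

lemma LGn_lim_aux (M : ℕ) (a : ℝ) (z : ℂ) (c : ℝ)
    (hc : Filter.Tendsto (fun n : ℕ => Real.log n.factorial -
    (n + 1/2) * Real.log n + n) Filter.atTop (nhds c)) :
    Filter.Tendsto (fun n : ℕ => (z + a) * (Real.log n : ℂ) + (Real.log n.factorial : ℂ)
      - stirS M a (z + (n+1:ℕ))) Filter.atTop (nhds (c:ℂ)) := by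
  have hinv : Filter.Tendsto (fun n : ℕ => ((n:ℂ))⁻¹) Filter.atTop (nhds 0) :=
    tendsto_inv_atTop_nhds_zero_nat
  have hsmall : Filter.Tendsto (fun n : ℕ => (z + 1) / (n:ℂ)) Filter.atTop (nhds 0) := by
    simpa [div_eq_mul_inv] using hinv.const_mul (z+1)
  have hlog0 : Filter.Tendsto (fun n : ℕ => Complex.log (1 + (z+1)/(n:ℂ))) Filter.atTop
      (nhds 0) := by
    have h1 : ContinuousAt Complex.log 1 := continuousAt_clog (by simp)
    have := h1.tendsto.comp (by simpa using hsmall.const_add 1 :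
      Filter.Tendsto (fun n : ℕ => 1 + (z + 1) / (n:ℂ)) Filter.atTop (nhds 1))
    simpa [Function.comp_def] using this
  have hlog1 : Filter.Tendsto (fun n : ℕ => (n:ℂ) * Complex.log (1 + (z+1)/(n:ℂ))) Filter.atTop
      (nhds (z+1)) := by
    exact Complex.tendsto_nat_mul_log_one_add_of_tendsto (g := fun n => (z+1)/(n:ℂ)) (by
      refine tendsto_const_nhds.congr' ?_
      filter_upwards [Filter.eventually_gt_atTop 0] with n hn
      have : (n:ℂ) ≠ 0 := by exact_mod_cast hn.ne'
      field_simp)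
  have hinv2 : Filter.Tendsto (fun n : ℕ => (z + (n+1:ℕ))⁻¹) Filter.atTop (nhds 0) := by
    apply Filter.tendsto_inv₀_cobounded.comp
    rw [← tendsto_norm_atTop_iff_cobounded]
    refine Filter.tendsto_atTop_mono (f := fun n : ℕ => (n:ℝ) + (1 - ‖z‖)) ?_ 
      (Filter.tendsto_atTop_add_const_right _ _ tendsto_natCast_atTop_atTop)
    intro n
    have := norm_sub_le (z + (n+1:ℕ)) z
    simp only [add_sub_cancel_left, Complex.norm_natCast] at this
    push_cast at this ⊢
    linarith
  have hsum : Filter.Tendsto (fun n : ℕ => ∑ m ∈ Finset.range M,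
    (-1)^m * ((bernoulliFun (m+2) a : ℝ) : ℂ) / (((m:ℂ)+1)*((m:ℂ)+2)) / (z + (n+1:ℕ))^(m+1))
      Filter.atTop (nhds 0) := by
    have : (0:ℂ) = ∑ m ∈ Finset.range M, 
      (-1)^m * ((bernoulliFun (m+2) a : ℝ) : ℂ) / (((m:ℂ)+1)*((m:ℂ)+2)) * 0^(m+1) := by
      simp
    rw [this]
    apply tendsto_finsetSum
    intro m _
    have := (hinv2.pow (m+1)).const_mul
      ((-1)^m * ((bernoulliFun (m+2) a : ℝ) : ℂ) / (((m:ℂ)+1)*((m:ℂ)+2)))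
    simpa [div_eq_mul_inv] using this
  have hc' : Filter.Tendsto (fun n : ℕ => ((Real.log n.factorial -
    (n + 1/2) * Real.log n + n : ℝ) : ℂ)) Filter.atTop (nhds (c:ℂ)) :=
    (Complex.continuous_ofReal.tendsto c).comp hc
  have htot := ((hc'.add_const (z+1)).sub (hlog1.add (hlog0.const_mul (z + a + 1/2)))).sub hsum
  have e : (c:ℂ) + (z+1) - ((z+1) + (z + a + 1/2) * 0) - 0 = c := by ring
  rw [e] at htot
  refine htot.congr' ?_
  have hne : ∀ᶠ n : ℕ in Filter.atTop, 1 + (z+1)/(n:ℂ) ≠ 0 := by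
    have : Filter.Tendsto (fun n : ℕ => 1 + (z + 1) / (n:ℂ)) Filter.atTop (nhds 1) := by
      simpa using hsmall.const_add 1
    exact this.eventually_ne one_ne_zero
  filter_upwards [Filter.eventually_gt_atTop 0, hne] with n hn hn2
  have hn' : (n:ℂ) ≠ 0 := by exact_mod_cast hn.ne'
  have hl : Complex.log (z + (n+1:ℕ)) = (Real.log n : ℂ) + Complex.log (1 + (z+1)/(n:ℂ)) := by
    rw [← Complex.log_ofReal_mul (by positivity) hn2]
    congr 1
    push_cast
    field_simp
    ring
  rw [stirS, hl]
  push_cast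
  ring

lemma LG_stir (M : ℕ) (R : ℝ) (hR : 1 ≤ R) (c : ℝ) (hc : Filter.Tendsto (fun n : ℕ =>
    Real.log n.factorial - (n + 1/2) * Real.log n + n) Filter.atTop (nhds c))
    (LG : ℂ → ℂ) (hLG : ∀ w ∈ Complex.slitPlane,
      Filter.Tendsto (fun n => LGn n w) Filter.atTop (nhds (LG w))) (a : ℝ) (z : ℂ)
    (hz : 0 ≤ z.re) (hz2 : 2*R ≤ ‖z‖) (ha : a ∈ Set.Icc (-R) R) :
    ‖LG (z + a) - stirS M a z - c‖ ≤
      (2*R)^(M+2) * ((M+1).factorial * 2^(M+2)) * (4/‖z‖^(M+1)) := by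
  have h1 := ((hLG (z+a) (slit_aux hR hz hz2 ha.1)).sub_const (stirS M a z)).sub
    (LGn_lim_aux M a z c hc)
  exact le_of_tendsto h1.norm (Filter.Eventually.of_forall fun n => LGn_stir M n R a z hR hz hz2 ha)
def lgT (j : ℕ) (w : ℂ) : ℂ :=
  w * Complex.log (1 + 1/((j:ℂ)+1)) - Complex.log (1 + w/((j:ℂ)+1))

lemma log_quad {v : ℂ} (hv : ‖v‖ ≤ 1/2) : ‖Complex.log (1+v) - v‖ ≤ ‖v‖^2 := by
  have h := Complex.norm_log_one_add_sub_self_le (z := v) (by linarith)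
  refine h.trans ?_
  have : (1 - ‖v‖)⁻¹ ≤ 2 := by
    rw [inv_le_comm₀ (by linarith) (by norm_num)]; linarith
  have h2 : 0 ≤ ‖v‖^2 := by positivity
  nlinarith

lemma lgT_bound (R : ℝ) (hR : 1 ≤ R) (j : ℕ) (hj : 2*R ≤ j) (w : ℂ) (hw : ‖w‖ ≤ R) :
    ‖lgT j w‖ ≤ (R + R^2) * (1/((j+1:ℕ):ℝ)^2) := by
  have hj1 : (0:ℝ) < ((j+1:ℕ):ℝ) := by positivity
  have hj2 : 2*R ≤ ((j+1:ℕ):ℝ) := by push_cast; linarith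
  have e : ((j:ℂ)+1) = (((j+1:ℕ):ℝ):ℂ) := by push_cast; ring
  have hn : ‖((j:ℂ)+1)‖ = ((j+1:ℕ):ℝ) := by
    rw [e, Complex.norm_real, Real.norm_eq_abs, abs_of_pos hj1]
  have h1 : ‖(1:ℂ)/((j:ℂ)+1)‖ = 1/((j+1:ℕ):ℝ) := by rw [norm_div, hn, norm_one]
  have h2 : ‖w/((j:ℂ)+1)‖ ≤ R/((j+1:ℕ):ℝ) := by rw [norm_div, hn]; gcongr
  have h3 := log_quad (v := (1:ℂ)/((j:ℂ)+1)) (by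
    rw [h1, div_le_div_iff₀ hj1 (by norm_num)]; linarith)
  have h4 := log_quad (v := w/((j:ℂ)+1)) (by
    refine h2.trans ?_
    rw [div_le_div_iff₀ hj1 (by norm_num)]; linarith)
  have heq : lgT j w = w * (Complex.log (1 + 1/((j:ℂ)+1)) - 1/((j:ℂ)+1)) -
      (Complex.log (1 + w/((j:ℂ)+1)) - w/((j:ℂ)+1)) := by
    rw [lgT]; ring
  rw [heq]
  refine (norm_sub_le _ _).trans ?_
  rw [norm_mul]
  have h5 : ‖w/((j:ℂ)+1)‖^2 ≤ (R/((j+1:ℕ):ℝ))^2 := by gcongr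
  rw [h1] at h3
  calc _ ≤ R * (1/((j+1:ℕ):ℝ))^2 + (R/((j+1:ℕ):ℝ))^2 := by
        refine add_le_add ?_ (h4.trans h5)
        gcongr
    _ = _ := by field_simp

lemma lgT_tail (R : ℝ) (hR : 1 ≤ R) : ∃ (K : ℕ) (u : ℕ → ℝ), Summable u ∧
    ∀ w : ℂ, ‖w‖ ≤ R → ∀ j, ‖lgT (j+K) w‖ ≤ u j := by
  refine ⟨⌈2*R⌉₊, fun j => (R + R^2) * (1/((j + (⌈2*R⌉₊ + 1) : ℕ):ℝ)^2), ?_, ?_⟩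
  · apply Summable.mul_left
    exact (summable_nat_add_iff (f := fun j : ℕ => 1/((j:ℝ))^2) (⌈2*R⌉₊ + 1)).2
      (Real.summable_one_div_nat_pow.2 (by norm_num))
  · intro w hw j
    refine lgT_bound R hR _ ?_ w hw
    push_cast
    have := Nat.le_ceil (2*R)
    have : (0:ℝ) ≤ j := Nat.cast_nonneg j
    linarith

def LG (w : ℂ) : ℂ := -Complex.log w + ∑' j, lgT j w

lemma lgT_summable (w : ℂ) : Summable (fun j => lgT j w) := by
  obtain ⟨K, u, hu, hb⟩ := lgT_tail (‖w‖ + 1) (by linarith [norm_nonneg w])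
  rw [← summable_nat_add_iff K]
  exact Summable.of_norm_bounded hu (hb w (by linarith))

lemma slit_one_add {w : ℂ} (hw : w ∈ Complex.slitPlane) (j : ℕ) :
    1 + w/((j:ℂ)+1) ∈ Complex.slitPlane := by
  have e : w/((j:ℂ)+1) = (((j:ℝ)+1)⁻¹ : ℝ) * w := by push_cast; field_simp
  have hp : 0 < ((j:ℝ)+1)⁻¹ := by positivity
  rw [e]
  rw [Complex.mem_slitPlane_iff] at hw ⊢
  rcases hw with h | h
  · left
    simp only [Complex.add_re, Complex.one_re, Complex.re_ofReal_mul]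
    positivity
  · right
    simp only [Complex.add_im, Complex.one_im, Complex.im_ofReal_mul, zero_add]
    exact mul_ne_zero hp.ne' h

lemma LG_continuousOn : ContinuousOn LG Complex.slitPlane := by
  intro w hw
  obtain ⟨K, u, hu, hb⟩ := lgT_tail (‖w‖ + 1) (by linarith [norm_nonneg w])
  apply ContinuousAt.continuousWithinAt
  have hT : ∀ j, ContinuousOn (lgT j) Complex.slitPlane := by
    intro j
    unfold lgT
    refine (continuousOn_id.mul continuousOn_const).sub (ContinuousOn.clog (by fun_prop) ?_)
    intro x hx
    exact slit_one_add hx j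
  have hU : Complex.slitPlane ∩ Metric.ball 0 (‖w‖+1) ∈ nhds w :=
    Filter.inter_mem (Complex.isOpen_slitPlane.mem_nhds hw)
      (Metric.isOpen_ball.mem_nhds (by simp))
  have h1 : ContinuousOn (fun w => ∑' j, lgT (j+K) w)
      (Complex.slitPlane ∩ Metric.ball 0 (‖w‖+1)) := by
    refine continuousOn_tsum (fun j => (hT _).mono Set.inter_subset_left) hu ?_
    intro j x hx
    refine hb x ?_ j
    have := hx.2
    rw [mem_ball_zero_iff] at this
    exact this.le
  have h2 : LG = fun w => -Complex.log w + (∑ j ∈ Finset.range K, lgT j w +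
      ∑' j, lgT (j+K) w) := by
    funext w
    rw [LG, ← (lgT_summable w).sum_add_tsum_nat_add K]
  rw [h2]
  refine (continuousAt_clog hw).neg.add (ContinuousAt.add ?_ (h1.continuousAt hU))
  refine tendsto_finsetSum _ fun j _ => ?_
  exact (hT j).continuousAt (Complex.isOpen_slitPlane.mem_nhds hw)

lemma LG_tendsto (w : ℂ) (hw : w ∈ Complex.slitPlane) :
    Filter.Tendsto (fun n => LGn n w) Filter.atTop (nhds (LG w)) := by
  have hw0 := Complex.slitPlane_ne_zero hw
  have h1 := ((lgT_summable w).hasSum.tendsto_sum_nat).const_add (-Complex.log w)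
  have h2 : Filter.Tendsto (fun n : ℕ => w * Complex.log (1 + 1/(n:ℂ))) Filter.atTop (nhds 0) := by
    have h0 : Filter.Tendsto (fun n : ℕ => 1 + 1/(n:ℂ)) Filter.atTop (nhds 1) := by
      simpa using (tendsto_inv_atTop_nhds_zero_nat (𝕜 := ℂ)).const_add 1
    have h1 : ContinuousAt Complex.log 1 := continuousAt_clog (by simp)
    simpa [Function.comp_def] using (h1.tendsto.comp h0).const_mul w
  have h3 := h1.sub h2
  rw [sub_zero] at h3
  refine h3.congr' ?_
  have hl : ∀ n : ℕ, Complex.log (1 + 1/((n:ℂ)+1)) =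
      ((Real.log ((n+1:ℕ)+1) : ℝ) : ℂ) - (Real.log (n+1:ℕ) : ℝ) := by
    intro n
    rw [← Complex.ofReal_sub, ← Real.log_div (by positivity) (by positivity), Complex.ofReal_log
      (by positivity)]
    congr 1
    push_cast
    have : (n:ℂ)+1 ≠ 0 := by exact_mod_cast Nat.succ_ne_zero n
    field_simp
  have key : ∀ n : ℕ, -Complex.log w + ∑ j ∈ Finset.range n, lgT j w =
      w * (Real.log ((n:ℝ)+1) : ℂ) + (Real.log n.factorial : ℂ) -
        ∑ k ∈ Finset.range (n+1), Complex.log (w + k) := by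
    intro n
    induction n with
    | zero => simp
    | succ n ih =>
      rw [Finset.sum_range_succ, ← add_assoc, ih, Finset.sum_range_succ _ (n+1), lgT, hl]
      have hne := Complex.slitPlane_ne_zero (slit_one_add hw n)
      have : Complex.log (w + (n+1:ℕ)) = (Real.log (n+1:ℕ) : ℂ) +
          Complex.log (1 + w/((n:ℂ)+1)) := by
        rw [← Complex.log_ofReal_mul (by positivity) hne]
        congr 1
        push_cast
        have : (n:ℂ)+1 ≠ 0 := by exact_mod_cast Nat.succ_ne_zero n
        field_simp
        ring
      rw [this, Nat.factorial_succ, Nat.cast_mul, Real.log_mul (by positivity) (by positivity)]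
      push_cast
      ring
  filter_upwards [Filter.eventually_gt_atTop 0] with n hn
  obtain ⟨m, rfl⟩ := Nat.exists_eq_succ_of_ne_zero hn.ne'
  rw [key, LGn]
  have := hl m
  simp only [Nat.succ_eq_add_one] at *
  push_cast at *
  rw [this]
  ring

lemma LG_exp (w : ℂ) (hw : w ∈ Complex.slitPlane) : Complex.exp (LG w) = Complex.Gamma w := by
  have h1 := (Complex.continuous_exp.tendsto _).comp (LG_tendsto w hw)
  refine tendsto_nhds_unique h1 ((Complex.GammaSeq_tendsto_Gamma w).congr' ?_)
  filter_upwards [Filter.eventually_gt_atTop 0] with n hn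
  have hn' : (n:ℂ) ≠ 0 := by exact_mod_cast hn.ne'
  have hne : ∀ k : ℕ, w + k ≠ 0 := by
    intro k hk
    rw [Complex.mem_slitPlane_iff] at hw
    have : w = -k := by linear_combination hk
    rw [this] at hw
    rcases hw with h | h
    · simp at h; linarith [Nat.cast_nonneg (α := ℝ) k]
    · simp at h
  simp only [Function.comp_apply, LGn]
  rw [Complex.exp_sub, Complex.exp_add, Complex.exp_sum, Complex.GammaSeq]
  congr 1
  · congr 1
    · rw [Complex.cpow_def_of_ne_zero hn', ← Complex.natCast_log, mul_comm]
    · rw [← Complex.ofReal_exp, Real.exp_log (by positivity)]; simp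
  · exact Finset.prod_congr rfl fun k _ => (Complex.exp_log (hne k)).symm

lemma norm_clog_le {v : ℂ} (hv : v ≠ 0) : ‖Complex.log v‖ ≤ ‖v‖ + 1/‖v‖ + 4 := by
  have hp : 0 < ‖v‖ := norm_pos_iff.2 hv
  have h1 := Complex.norm_le_abs_re_add_abs_im (Complex.log v)
  rw [Complex.log_re, Complex.log_im] at h1
  have h2 := Complex.abs_arg_le_pi v
  have h3 : |Real.log ‖v‖| ≤ ‖v‖ + 1/‖v‖ := by
    have a1 := Real.log_le_sub_one_of_pos hp
    have a2 := Real.log_le_sub_one_of_pos (inv_pos.2 hp)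
    rw [Real.log_inv] at a2
    rw [one_div]
    have := inv_pos.2 hp
    rw [abs_le]
    constructor <;> linarith
  linarith [Real.pi_le_four]

lemma LG_bound (R : ℝ) (hR : 1 ≤ R) : ∃ C, ∀ w : ℂ, ‖w‖ ≤ R → w.im ≠ 0 →
    ‖LG w‖ ≤ C / |w.im| := by
  obtain ⟨K, u, hu, hb⟩ := lgT_tail R hR
  refine ⟨(R + 1/R*R + 4)*R + 1 + (∑ j ∈ Finset.range K,
    ((R * ‖Complex.log (1 + 1/((j:ℂ)+1))‖ + (1 + R) + 4) * R + (j+1))) + (∑' j, u j) * R, ?_⟩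
  intro w hw him
  have hw0 : w ≠ 0 := fun h => him (by simp [h])
  have hi : 0 < |w.im| := abs_pos.2 him
  have hiR : |w.im| ≤ R := (Complex.abs_im_le_norm w).trans hw
  have hconst : ∀ x : ℝ, 0 ≤ x → x ≤ x * R / |w.im| := by
    intro x hx
    rw [le_div_iff₀ hi]; gcongr
  have hlogb : ∀ v : ℂ, ∀ q B : ℝ, 0 < q → |w.im| ≤ q * |v.im| → ‖v‖ ≤ B →
      ‖Complex.log v‖ ≤ B + 4 + q/|w.im| := by
    intro v q B hq h1 h2
    have hv1 : |v.im| ≤ ‖v‖ := Complex.abs_im_le_norm v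
    have hv0 : 0 < |v.im| := by
      by_contra hh
      have : |v.im| = 0 := le_antisymm (not_lt.1 hh) (abs_nonneg _)
      rw [this] at h1; linarith
    have hvp : 0 < ‖v‖ := by linarith
    have := norm_clog_le (norm_pos_iff.1 hvp)
    have h3 : 1/‖v‖ ≤ q/|w.im| := by
      rw [div_le_div_iff₀ hvp hi]
      nlinarith
    linarith
  have h1 : ‖Complex.log w‖ ≤ ((R + 1/R*R + 4)*R + 1)/|w.im| := by
    have h := hlogb w 1 R one_pos (by simp) hw
    have h' := hconst (R + 1/R*R + 4) (by positivity)
    have : 0 ≤ 1/R*R := by positivity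
    rw [add_div]; linarith
  have h2 : ∀ j ∈ Finset.range K, ‖lgT j w‖ ≤
      ((R * ‖Complex.log (1 + 1/((j:ℂ)+1))‖ + (1 + R) + 4) * R + (j+1))/|w.im| := by
    intro j _
    have e : w/((j:ℂ)+1) = (((j:ℝ)+1)⁻¹ : ℝ) * w := by push_cast; field_simp
    have hp : 0 < ((j:ℝ)+1)⁻¹ := by positivity
    have hv := hlogb (1 + w/((j:ℂ)+1)) (j+1) (1+R) (by positivity) (by
      rw [e]
      simp only [Complex.add_im, Complex.one_im, Complex.im_ofReal_mul, zero_add, abs_mul,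
        abs_of_pos hp]
      rw [← mul_assoc, mul_inv_cancel₀ (by positivity), one_mul]) (by
      refine (norm_add_le _ _).trans ?_
      rw [norm_one, e, norm_mul, Complex.norm_real, Real.norm_eq_abs, abs_of_pos hp]
      have : ((j:ℝ)+1)⁻¹ ≤ 1 := by
        apply inv_le_one_of_one_le₀
        linarith [Nat.cast_nonneg (α := ℝ) j]
      nlinarith [norm_nonneg w])
    have h' := hconst (R * ‖Complex.log (1 + 1/((j:ℂ)+1))‖ + (1 + R) + 4) (by positivity)
    have h3 : ‖lgT j w‖ ≤ ‖w‖ * ‖Complex.log (1 + 1/((j:ℂ)+1))‖ +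
        ‖Complex.log (1 + w/((j:ℂ)+1))‖ := by
      rw [lgT, ← norm_mul]; exact norm_sub_le _ _
    have h4 : ‖w‖ * ‖Complex.log (1 + 1/((j:ℂ)+1))‖ ≤ R * ‖Complex.log (1 + 1/((j:ℂ)+1))‖ := by
      gcongr
    rw [add_div]; linarith
  have h3 : ‖∑' j, lgT (j+K) w‖ ≤ (∑' j, u j) * R/|w.im| := by
    have hh : ‖∑' j, lgT (j+K) w‖ ≤ ∑' j, u j := tsum_of_norm_bounded hu.hasSum (hb w hw)
    exact hh.trans (hconst _ ((norm_nonneg _).trans hh))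
  rw [LG, ← (lgT_summable w).sum_add_tsum_nat_add K, ← add_assoc, add_div, add_div]
  refine norm_add_le_of_le (norm_add_le_of_le (by rwa [norm_neg]) ?_) h3
  rw [Finset.sum_div]
  exact norm_sum_le_of_le _ h2
lemma const_of_exp (D : ℂ → ℂ) (hD : ContinuousOn D RSOmega)
    (he : ∀ s ∈ RSOmega, Complex.exp (D s) = 1) (h0 : D (1/2) = 0) :
    ∀ s ∈ RSOmega, D s = 0 := by
  have hmem : (1/2 : ℂ) ∈ RSOmega := by
    right; norm_num
  have hstar : StarConvex ℝ (1/2 : ℂ) RSOmega := by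
    intro s hs p q hp hq hpq
    rcases hq.eq_or_lt with h | h
    · have : p = 1 := by linarith
      rw [← h, this]; simpa using hmem
    · rcases hs with h1 | h1
      · left
        simp [h1, h.ne']
      · right
        simp
        constructor <;> nlinarith
  have hconn : IsPreconnected RSOmega := (hstar.isPathConnected hmem).isConnected.isPreconnected
  intro s hs
  obtain ⟨n, hn⟩ := Complex.exp_eq_one_iff.1 (he s hs)
  have hf : ContinuousOn (fun s => (D s).im) RSOmega := Complex.continuous_im.comp_continuousOn hD
  have him : (D s).im = n * (2*π) := by rw [hn]; simp
  have hval : ∀ s ∈ RSOmega, ∃ m : ℤ, (D s).im = m * (2*π) := by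
    intro s hs
    obtain ⟨m, hm⟩ := Complex.exp_eq_one_iff.1 (he s hs)
    exact ⟨m, by rw [hm]; simp⟩
  have hpi := Real.pi_pos
  rcases lt_trichotomy n 0 with h | h | h
  · exfalso
    have hn1 : (n:ℝ) ≤ -1 := by exact_mod_cast Int.le_sub_one_of_lt h
    have := hconn.intermediate_value hs hmem hf
    obtain ⟨x, hx, hx2⟩ := this (show -π ∈ Set.Icc (D s).im (D (1/2)).im by
      rw [him, h0]; constructor
      · nlinarith
      · simp; positivity)
    obtain ⟨m, hm⟩ := hval x hx
    have hh : (D x).im = -π := hx2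
    rw [hh] at hm
    have h3 : (2*m+1 : ℝ) = 0 := by
      have : π * (2*m+1) = 0 := by linarith
      rcases mul_eq_zero.1 this with h | h
      · exact absurd h hpi.ne'
      · exact h
    have h4 : (2*m+1 : ℤ) = 0 := by exact_mod_cast h3
    omega
  · rw [hn, h]; simp
  · exfalso
    have hn1 : (1:ℝ) ≤ n := by exact_mod_cast h
    have := hconn.intermediate_value hmem hs hf
    obtain ⟨x, hx, hx2⟩ := this (show π ∈ Set.Icc (D (1/2)).im (D s).im by
      rw [him, h0]; constructor
      · simp; positivity
      · nlinarith)
    obtain ⟨m, hm⟩ := hval x hx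
    have hh : (D x).im = π := hx2
    rw [hh] at hm
    have h3 : (2*m-1 : ℝ) = 0 := by
      have : π * (2*m-1) = 0 := by linarith
      rcases mul_eq_zero.1 this with h | h
      · exact absurd h hpi.ne'
      · exact h
    have h4 : (2*m-1 : ℤ) = 0 := by exact_mod_cast h3
    omega

lemma omega_slit1 {s : ℂ} (hs : s ∈ RSOmega) : s/2 ∈ Complex.slitPlane := by
  rw [Complex.mem_slitPlane_iff]
  rcases hs with h | h
  · right; simpa using h
  · left; simpa using h.1

lemma omega_slit2 {s : ℂ} (hs : s ∈ RSOmega) : (1-s)/2 ∈ Complex.slitPlane := by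
  rw [Complex.mem_slitPlane_iff]
  rcases hs with h | h
  · right; simpa using h
  · left; simpa using h.2

lemma theta_eq (ϑ : ℂ → ℂ) (hϑ : IsRSTheta ϑ) (s : ℂ) (hs : s ∈ RSOmega) :
    I * ϑ s = (LG (s/2) - LG ((1-s)/2))/2 - (s/2 - 1/4) * (Real.log π : ℂ) := by
  obtain ⟨h1, h2, h3⟩ := hϑ
  have key := const_of_exp
    (fun s => -2 * I * ϑ s - ((s - 1/2) * (Real.log π : ℂ) + LG ((1-s)/2) - LG (s/2))) ?_ ?_ ?_ s hs
  · linear_combination (-1/2) * key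
  · refine (continuousOn_const.mul h1.continuousOn).sub (ContinuousOn.sub (ContinuousOn.add
      (by fun_prop) ?_) ?_)
    · exact LG_continuousOn.comp (by fun_prop) fun x hx => omega_slit2 hx
    · exact LG_continuousOn.comp (by fun_prop) fun x hx => omega_slit1 hx
  · intro s hs
    have hpi : (π:ℂ) ≠ 0 := by exact_mod_cast Real.pi_ne_zero
    have e : Complex.exp ((s - 1/2) * (Real.log π : ℂ)) = (π:ℂ)^(s-1/2) := by
      rw [Complex.cpow_def_of_ne_zero hpi, Complex.ofReal_log Real.pi_pos.le, mul_comm]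
    have hc : chi s ≠ 0 := by rw [← h2 s hs]; exact Complex.exp_ne_zero _
    rw [Complex.exp_sub, Complex.exp_sub, Complex.exp_add, LG_exp _ (omega_slit1 hs),
      LG_exp _ (omega_slit2 hs), e, h2 s hs]
    exact div_self hc
  · simp only [h3]
    norm_num

lemma bern_cast (n : ℕ) (x : ℝ) : bernoulliPoly n (x:ℂ) = ((bernoulliFun n x : ℝ) : ℂ) := by
  unfold bernoulliPoly bernoulliFun
  rw [Polynomial.eval_map_algebraMap]
  exact Polynomial.aeval_algebraMap_apply ℂ x _

/-- the quantity to be bounded -/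
def errE (M : ℕ) (ϑ : ℂ → ℂ) (s : ℂ) : ℂ :=
  I * ϑ s - (s/2 - 1/4) * (Real.log (|s.im|/(2*π)) : ℂ) + I*(s.im:ℂ)/2
          + (Real.sign s.im : ℂ) * I * (π:ℂ)/8
          + ∑ n ∈ Finset.range M, (2*I/(s.im:ℂ))^(n+1) *
              ((((bernoulliFun (n+2) (s.re/2) : ℝ) : ℂ)
                  + (-1:ℂ)^n * ((bernoulliFun (n+2) ((1-s.re)/2) : ℝ) : ℂ)) /
                (2*((n:ℂ)+1)*((n:ℂ)+2)))

lemma errE_eq (M : ℕ) (ϑ : ℂ → ℂ) (hϑ : IsRSTheta ϑ) (s : ℂ) (hs : s.im ≠ 0) (c : ℝ) :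
    errE M ϑ s = ((LG (I * (s.im:ℂ)/2 + ((s.re/2 : ℝ):ℂ)) - stirS M (s.re/2) (I * (s.im:ℂ)/2) - c)
      - (LG (-(I * (s.im:ℂ)/2) + (((1-s.re)/2 : ℝ):ℂ)) -
        stirS M ((1-s.re)/2) (-(I * (s.im:ℂ)/2)) - c))/2 := by
  have hs' : (s.im : ℂ) ≠ 0 := by exact_mod_cast hs
  have hsre : s = (s.re : ℂ) + I * (s.im : ℂ) := by
    conv_lhs => rw [← Complex.re_add_im s]
    ring
  have e1 : I * (s.im:ℂ)/2 + ((s.re/2 : ℝ):ℂ) = s/2 := by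
    push_cast; linear_combination (-1/2) * hsre
  have e2 : -(I * (s.im:ℂ)/2) + (((1-s.re)/2 : ℝ):ℂ) = (1-s)/2 := by
    push_cast; linear_combination (1/2) * hsre
  have habs : 0 < |s.im| := abs_pos.2 hs
  have hlogd : Real.log (|s.im|/(2*π)) = Real.log (|s.im|/2) - Real.log π := by
    rw [← Real.log_div (by positivity) Real.pi_ne_zero]
    congr 1; field_simp
  have hI : Complex.log I = π/2 * I := Complex.log_I
  have hnI : Complex.log (-I) = -(π/2) * I := Complex.log_neg_I
  have hl1 : Complex.log (I * (s.im:ℂ)/2) = (Real.log (|s.im|/2) : ℂ) +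
      (Real.sign s.im : ℂ) * (π/2 * I) := by
    rcases lt_or_gt_of_ne hs with h | h
    · rw [Real.sign_of_neg h, abs_of_neg h]
      have : I * (s.im:ℂ)/2 = ((-s.im/2 : ℝ) : ℂ) * (-I) := by push_cast; ring
      rw [this, Complex.log_ofReal_mul (by linarith) (by simp), hnI]
      push_cast; ring
    · rw [Real.sign_of_pos h, abs_of_pos h]
      have : I * (s.im:ℂ)/2 = ((s.im/2 : ℝ) : ℂ) * I := by push_cast; ring
      rw [this, Complex.log_ofReal_mul (by linarith) (by simp), hI]
      push_cast; ring
  have hl2 : Complex.log (-(I * (s.im:ℂ)/2)) = (Real.log (|s.im|/2) : ℂ) -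
      (Real.sign s.im : ℂ) * (π/2 * I) := by
    rcases lt_or_gt_of_ne hs with h | h
    · rw [Real.sign_of_neg h, abs_of_neg h]
      have : -(I * (s.im:ℂ)/2) = ((-s.im/2 : ℝ) : ℂ) * I := by push_cast; ring
      rw [this, Complex.log_ofReal_mul (by linarith) (by simp), hI]
      push_cast; ring
    · rw [Real.sign_of_pos h, abs_of_pos h]
      have : -(I * (s.im:ℂ)/2) = ((s.im/2 : ℝ) : ℂ) * (-I) := by push_cast; ring
      rw [this, Complex.log_ofReal_mul (by linarith) (by simp), hnI]
      push_cast; ring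
  have hsum : ∑ n ∈ Finset.range M, (2*I/(s.im:ℂ))^(n+1) *
              ((((bernoulliFun (n+2) (s.re/2) : ℝ) : ℂ)
                  + (-1:ℂ)^n * ((bernoulliFun (n+2) ((1-s.re)/2) : ℝ) : ℂ)) /
                (2*((n:ℂ)+1)*((n:ℂ)+2))) =
      (-1/2) * ((∑ n ∈ Finset.range M, (-1)^n * ((bernoulliFun (n+2) (s.re/2) : ℝ) : ℂ) /
          (((n:ℂ)+1)*((n:ℂ)+2)) / (I * (s.im:ℂ)/2)^(n+1)) -
        ∑ n ∈ Finset.range M, (-1)^n * ((bernoulliFun (n+2) ((1-s.re)/2) : ℝ) : ℂ) /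
          (((n:ℂ)+1)*((n:ℂ)+2)) / (-(I * (s.im:ℂ)/2))^(n+1)) := by
    rw [← Finset.sum_sub_distrib, Finset.mul_sum]
    apply Finset.sum_congr rfl
    intro n _
    have q1 : (I * (s.im:ℂ)/2)⁻¹ = -(2*I/(s.im:ℂ)) := by
      have : I ≠ 0 := Complex.I_ne_zero
      field_simp
      simp
    have q2 : (-(I * (s.im:ℂ)/2))⁻¹ = (2*I/(s.im:ℂ)) := by
      rw [inv_neg, q1, neg_neg]
    rw [div_eq_mul_inv _ ((I * (s.im:ℂ)/2)^(n+1)), div_eq_mul_inv _ ((-(I * (s.im:ℂ)/2))^(n+1)),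
      ← inv_pow, ← inv_pow, q1, q2, neg_pow (2*I/(s.im:ℂ)) (n+1)]
    have hpm : (-1:ℂ)^n * (-1)^n = 1 := by rw [← mul_pow]; simp
    have h2 : ((n:ℂ)+2) ≠ 0 := by exact_mod_cast Nat.succ_ne_zero (n+1)
    have h3 : ((n:ℂ)+1) ≠ 0 := by exact_mod_cast Nat.succ_ne_zero (n)
    generalize (2*I/(s.im:ℂ))^(n+1) = q
    rw [pow_succ]
    field_simp
    linear_combination (-q * ((bernoulliFun (n+2) (s.re/2) : ℝ) : ℂ)) * hpm
  rw [errE, theta_eq ϑ hϑ s (Or.inl hs), hsum, e1, e2, stirS, stirS, hl1, hl2, hlogd]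
  have hre : (s.re:ℂ) = s - I * (s.im:ℂ) := by linear_combination -hsre
  push_cast
  generalize (∑ n ∈ Finset.range M, (-1)^n * ((bernoulliFun (n+2) (s.re/2) : ℝ) : ℂ) /
          (((n:ℂ)+1)*((n:ℂ)+2)) / (I * (s.im:ℂ)/2)^(n+1)) = X
  generalize (∑ n ∈ Finset.range M, (-1)^n * ((bernoulliFun (n+2) ((1-s.re)/2) : ℝ) : ℂ) /
          (((n:ℂ)+1)*((n:ℂ)+2)) / (-(I * (s.im:ℂ)/2))^(n+1)) = Y
  rw [hre]
  ring

lemma large_bound (M : ℕ) (ϑ : ℂ → ℂ) (hϑ : IsRSTheta ϑ) (R : ℝ) (hR : 1 ≤ R) :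
    ∃ C, ∀ s : ℂ, s.re/2 ∈ Set.Icc (-R) R → (1-s.re)/2 ∈ Set.Icc (-R) R → 4*R ≤ |s.im| →
      ‖errE M ϑ s‖ ≤ C/|s.im|^(M+1) := by
  obtain ⟨c, hc⟩ := stirling_lim
  refine ⟨(2*R)^(M+2) * ((M+1).factorial * 2^(M+2)) * 4 * 2^(M+1), ?_⟩
  intro s h1 h2 h3
  have hs : s.im ≠ 0 := by
    intro h; rw [h] at h3; simp at h3; linarith
  have hn : ‖I * (s.im:ℂ)/2‖ = |s.im|/2 := by simp
  have b1 := LG_stir M R hR c hc LG LG_tendsto (s.re/2) (I * (s.im:ℂ)/2) (by simp)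
    (by rw [hn]; linarith) h1
  have b2 := LG_stir M R hR c hc LG LG_tendsto ((1-s.re)/2) (-(I * (s.im:ℂ)/2)) (by simp)
    (by rw [norm_neg, hn]; linarith) h2
  rw [norm_neg] at b2
  rw [hn] at b1 b2
  rw [errE_eq M ϑ hϑ s hs c, norm_div, Complex.norm_ofNat, div_le_iff₀ (by norm_num)]
  refine (norm_sub_le_of_le b1 b2).trans (le_of_eq ?_)
  rw [div_pow]
  have : |s.im| ≠ 0 := abs_ne_zero.2 hs
  field_simp
  ring
/-- `f` is `O(|t|^{-n})` in a bounded part of the strip -/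
def SmallB (R : ℝ) (n : ℕ) (f : ℂ → ℂ) : Prop :=
  ∃ C, ∀ s : ℂ, |s.re| ≤ R → s.im ≠ 0 → |s.im| ≤ R → ‖f s‖ ≤ C/|s.im|^n

lemma SmallB.add {R : ℝ} {n : ℕ} {f g : ℂ → ℂ} (hf : SmallB R n f) (hg : SmallB R n g) :
    SmallB R n (fun s => f s + g s) := by
  obtain ⟨C, hC⟩ := hf
  obtain ⟨D, hD⟩ := hg
  refine ⟨C + D, fun s h1 h2 h3 => ?_⟩
  rw [add_div]
  exact norm_add_le_of_le (hC s h1 h2 h3) (hD s h1 h2 h3)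

lemma SmallB.mul {R : ℝ} {n m : ℕ} {f g : ℂ → ℂ} (hf : SmallB R n f) (hg : SmallB R m g) :
    SmallB R (n+m) (fun s => f s * g s) := by
  obtain ⟨C, hC⟩ := hf
  obtain ⟨D, hD⟩ := hg
  refine ⟨C * D, fun s h1 h2 h3 => ?_⟩
  rw [norm_mul, pow_add, ← div_mul_div_comm]
  exact mul_le_mul (hC s h1 h2 h3) (hD s h1 h2 h3) (norm_nonneg _)
    ((norm_nonneg _).trans (hC s h1 h2 h3))

lemma SmallB.mono {R : ℝ} {n m : ℕ} {f : ℂ → ℂ} (hf : SmallB R n f) (h : n ≤ m) :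
    SmallB R m f := by
  obtain ⟨C, hC⟩ := hf
  refine ⟨|C| * R^(m-n), fun s h1 h2 h3 => ?_⟩
  have hp : 0 < |s.im| := abs_pos.2 h2
  refine (hC s h1 h2 h3).trans ?_
  obtain ⟨k, rfl⟩ := Nat.exists_eq_add_of_le h
  rw [div_le_div_iff₀ (by positivity) (by positivity), Nat.add_sub_cancel_left, pow_add]
  have h4 : |s.im|^k ≤ R^k := by gcongr
  calc C * (|s.im|^n * |s.im|^k) ≤ |C| * (|s.im|^n * R^k) := by
        gcongr
        exact le_abs_self C
    _ = _ := by ring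

lemma SmallB.const {R : ℝ} (c : ℂ) : SmallB R 0 (fun _ => c) :=
  ⟨‖c‖, fun s _ _ _ => by simp⟩

lemma SmallB.sum {R : ℝ} {n : ℕ} (M : ℕ) {f : ℕ → ℂ → ℂ} (hf : ∀ i < M, SmallB R n (f i)) :
    SmallB R n (fun s => ∑ i ∈ Finset.range M, f i s) := by
  induction M with
  | zero => simpa using (SmallB.const (R := R) 0).mono (Nat.zero_le n)
  | succ M ih =>
    simp only [Finset.sum_range_succ]
    exact (ih fun i hi => hf i (by omega)).add (hf M (by omega))

lemma SmallB.of_cont {R : ℝ} {f : ℝ → ℝ} (hf : Continuous f) :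
    SmallB R 0 (fun s => ((f s.re : ℝ) : ℂ)) := by
  obtain ⟨C, hC⟩ := (isCompact_Icc (a := -R) (b := R)).exists_bound_of_continuousOn hf.continuousOn
  refine ⟨C, fun s h1 _ _ => ?_⟩
  rw [Complex.norm_real]
  simpa using hC s.re (abs_le.1 h1)

lemma small_bound (M : ℕ) (ϑ : ℂ → ℂ) (hϑ : IsRSTheta ϑ) (R : ℝ) (hR : 1 ≤ R) :
    SmallB R (M+1) (errE M ϑ) := by
  have hnorm : ∀ s : ℂ, |s.re| ≤ R → |s.im| ≤ R → ‖s‖ ≤ 2*R := fun s h1 h2 =>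
    (Complex.norm_le_abs_re_add_abs_im s).trans (by linarith)
  have hid : SmallB R 0 (fun s => s) := ⟨2*R, fun s h1 _ h3 => by simpa using hnorm s h1 h3⟩
  obtain ⟨C, hC⟩ := LG_bound (2*R) (by linarith)
  have hL1 : SmallB R 1 (fun s => LG (s/2)) := by
    refine ⟨C*2, fun s h1 h2 h3 => ?_⟩
    have := hC (s/2) (by
      have := hnorm s h1 h3
      rw [norm_div, Complex.norm_ofNat]; linarith [norm_nonneg s]) (by simpa using h2)
    refine this.trans (le_of_eq ?_)
    have hp : |s.im| ≠ 0 := abs_ne_zero.2 h2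
    simp [abs_div]
    field_simp
  have hL2 : SmallB R 1 (fun s => LG ((1-s)/2)) := by
    refine ⟨C*2, fun s h1 h2 h3 => ?_⟩
    have := hC ((1-s)/2) (by
      have := hnorm s h1 h3
      have h4 := norm_sub_le (1:ℂ) s
      rw [norm_one] at h4
      rw [norm_div, Complex.norm_ofNat]; linarith [norm_nonneg s]) (by simpa using h2)
    refine this.trans (le_of_eq ?_)
    have hp : |s.im| ≠ 0 := abs_ne_zero.2 h2
    simp [abs_div]
    field_simp
  have hlin : SmallB R 0 (fun s => s * (1/2) + (-1/4)) :=
    (hid.mul (SmallB.const (1/2))).add (SmallB.const (-1/4))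
  have hlog : SmallB R 1 (fun s => (Real.log (|s.im|/(2*π)) : ℂ)) := by
    refine ⟨R*R + 2*π + 4*R, fun s h1 h2 h3 => ?_⟩
    have hp : 0 < |s.im| := abs_pos.2 h2
    have hpi := Real.pi_pos
    have hpi3 := Real.pi_gt_three
    beta_reduce
    rw [Complex.ofReal_log (by positivity)]
    have hv : ‖((|s.im|/(2*π) : ℝ) : ℂ)‖ = |s.im|/(2*π) := by
      rw [Complex.norm_real, Real.norm_eq_abs, abs_of_pos (by positivity)]
    have := norm_clog_le (v := ((|s.im|/(2*π) : ℝ) : ℂ)) (by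
      exact_mod_cast (by positivity : |s.im|/(2*π) ≠ 0))
    rw [hv] at this
    refine this.trans ?_
    rw [pow_one, le_div_iff₀ hp, add_mul, add_mul]
    have a1 : |s.im|/(2*π) ≤ R := by
      rw [div_le_iff₀ (by positivity)]; nlinarith
    have a2 : 1/(|s.im|/(2*π)) * |s.im| = 2*π := by field_simp
    rw [a2]
    have a3 : |s.im|/(2*π) * |s.im| ≤ R * R := by gcongr
    linarith
  have him : SmallB R 0 (fun s => (s.im : ℂ)) :=
    ⟨R, fun s _ _ h3 => by rw [Complex.norm_real]; simpa using h3⟩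
  have hsgn : SmallB R 0 (fun s => (Real.sign s.im : ℂ)) := by
    refine ⟨1, fun s _ h2 _ => ?_⟩
    rcases lt_or_gt_of_ne h2 with h | h
    · simp [Real.sign_of_neg h]
    · simp [Real.sign_of_pos h]
  have hq : ∀ n, SmallB R n (fun s => (2*I/(s.im:ℂ))^n) := by
    intro n
    refine ⟨2^n, fun s _ h2 _ => ?_⟩
    simp [div_pow]
  have h1 : SmallB R 1 (fun s => (1/2) * (LG (s/2) + (-1) * LG ((1-s)/2)) +
      (-(Real.log π : ℂ)) * (s * (1/2) + (-1/4))) := by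
    have a := (SmallB.const (R := R) (1/2)).mul (hL1.add ((SmallB.const (-1)).mul hL2))
    have b := (SmallB.const (R := R) (-(Real.log π : ℂ))).mul hlin
    exact (a.mono (by norm_num)).add (b.mono (by norm_num))
  have h2 := hlin.mul hlog
  have h3 := him.mul (SmallB.const (R := R) (I/2))
  have h4 := hsgn.mul (SmallB.const (R := R) (I * (π:ℂ)/8))
  have hB : SmallB R (M+1) (fun s => ∑ n ∈ Finset.range M, (2*I/(s.im:ℂ))^(n+1) *
              ((((bernoulliFun (n+2) (s.re/2) : ℝ) : ℂ)
                  + (-1:ℂ)^n * ((bernoulliFun (n+2) ((1-s.re)/2) : ℝ) : ℂ)) *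
                (2*((n:ℂ)+1)*((n:ℂ)+2))⁻¹)) := by
    apply SmallB.sum
    intro n hn
    have b1 := SmallB.of_cont (R := R) (f := fun x => bernoulliFun (n+2) (x/2)) (by fun_prop)
    have b2 := SmallB.of_cont (R := R) (f := fun x => bernoulliFun (n+2) ((1-x)/2)) (by fun_prop)
    have b3 := (hq (n+1)).mul ((b1.add ((SmallB.const ((-1:ℂ)^n)).mul b2)).mul
      (SmallB.const (2*((n:ℂ)+1)*((n:ℂ)+2))⁻¹))
    exact b3.mono (by omega)
  have tot := ((((h1.mono (show 1 ≤ M+1 by omega)).add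
    (((SmallB.const (-1)).mul h2).mono (show 0 + (0+1) ≤ M+1 by omega))).add
    (h3.mono (show 0 + 0 ≤ M+1 by omega))).add (h4.mono (show 0 + 0 ≤ M+1 by omega))).add hB
  obtain ⟨D, hD⟩ := tot
  refine ⟨D, fun s a1 a2 a3 => ?_⟩
  refine le_trans (le_of_eq ?_) (hD s a1 a2 a3)
  rw [errE, theta_eq ϑ hϑ s (Or.inl a2)]
  simp only [← div_eq_mul_inv]
  congr 2
  ring

theorem statement16 (A B : ℝ) (N : ℕ) (hN : 1 ≤ N) (ϑ : ℂ → ℂ) (hϑ : IsRSTheta ϑ) :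
    ∃ C : ℝ, ∀ s : ℂ, s.re ∈ Set.Icc A B → s.im ≠ 0 →
      ‖I * ϑ s - (s/2 - 1/4) * (Real.log (|s.im|/(2*π)) : ℂ) + I*(s.im:ℂ)/2
          + (Real.sign s.im : ℂ) * I * (π:ℂ)/8
          + ∑ n ∈ Finset.Icc 1 (N-1), (2*I/(s.im:ℂ))^n *
              ((bernoulliPoly (n+1) ((s.re:ℂ)/2)
                  + (-1:ℂ)^(n+1) * bernoulliPoly (n+1) ((1-(s.re:ℂ))/2)) /
                (2*(n:ℂ)*((n:ℂ)+1)))‖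
        ≤ C / |s.im|^N := by
  obtain ⟨M, rfl⟩ := Nat.exists_eq_add_of_le' hN
  set R : ℝ := |A| + |B| + 1 with hRdef
  have hR : 1 ≤ R := by have := abs_nonneg A; have := abs_nonneg B; linarith
  obtain ⟨C1, hC1⟩ := large_bound M ϑ hϑ R hR
  obtain ⟨C2, hC2⟩ := small_bound M ϑ hϑ (4*R) (by linarith)
  refine ⟨max C1 C2, fun s hs him => ?_⟩
  have hp : 0 < |s.im| := abs_pos.2 him
  have hre : |s.re| ≤ R - 1 := by
    have h1 := neg_abs_le A
    have h2 := le_abs_self B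
    have h3 := abs_nonneg A
    have h4 := abs_nonneg B
    rw [abs_le]
    constructor <;> linarith [hs.1, hs.2]
  have key : ‖errE M ϑ s‖ ≤ max C1 C2 / |s.im|^(M+1) := by
    rcases le_total (4*R) |s.im| with h | h
    · have hre' := abs_le.1 hre
      refine (hC1 s ⟨by linarith [hre'.1], by linarith [hre'.2]⟩
        ⟨by linarith [hre'.2], by linarith [hre'.1]⟩ h).trans ?_
      gcongr
      exact le_max_left _ _
    · refine (hC2 s (by linarith) him h).trans ?_
      gcongr
      exact le_max_right _ _
  refine le_trans (le_of_eq ?_) key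
  rw [errE]
  congr 2
  rw [Nat.add_sub_cancel]
  have hIcc : Finset.Icc 1 M = Finset.Ico (0+1) (M+1) := by
    ext x; simp only [Finset.mem_Icc, Finset.mem_Ico]; omega
  rw [hIcc, ← Finset.sum_Ico_add', ← Finset.range_eq_Ico]
  apply Finset.sum_congr rfl
  intro n _
  have e1 : (s.re:ℂ)/2 = ((s.re/2 : ℝ) : ℂ) := by push_cast; ring
  have e2 : (1-(s.re:ℂ))/2 = (((1-s.re)/2 : ℝ) : ℂ) := by push_cast; ring
  rw [e1, e2, bern_cast, bern_cast, pow_add (-1:ℂ) (n+1) 1, pow_succ (-1:ℂ) n]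
  have e3 : ((n+1:ℕ):ℂ) + 1 = (n:ℂ) + 2 := by push_cast; ring
  rw [e3]
  push_cast
  simp
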